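/- arXiv:1509.01389 — 9 statements merged into one kernel-verified Lean document; each statement's English description precedes it below -/
import Mathlib

section
/- Let S be a compact Hausdorff reductive topological semigroup. Then on the translational hull Ω(S) the compact-open topology coincides with the topology of pointwise convergence, and Ω(S), with the compact-open topology, is a compact Hausdorff topological semigroup (its multiplication is continuous and the space is compact). -/
open Filter Topology

section Hull

variable {T : Type*} [Semigroup T] [TopologicalSpace T]

/-- A left translation of a topological semigroup. -/
def IsLeftTranslation (l : C(T, T)) : Prop :=
  ∀ s t : T, l (s * t) = l s * t

/-- A right translation of a topological semigroup. -/
def IsRightTranslation (r : C(T, T)) : Prop :=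
  ∀ s t : T, r (s * t) = s * r t

/-- A bitranslation: a linked pair of a left and a right translation. -/
def IsBitranslation (p : C(T, T) × C(T, T)) : Prop :=
  IsLeftTranslation p.1 ∧ IsRightTranslation p.2 ∧ ∀ s t : T, s * p.1 t = p.2 s * t

/-- The translational hull of a topological semigroup, topologized as a subspace of
`C(T,T) × C(T,T)` where both factors carry the compact-open topology. -/
abbrev TranslationalHull (T : Type*) [Semigroup T] [TopologicalSpace T] :=
  { p : C(T, T) × C(T, T) // IsBitranslation p }

instance : Mul (TranslationalHull T) where
  mul p q :=
    ⟨(p.1.1.comp q.1.1, q.1.2.comp p.1.2), by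
      obtain ⟨⟨l₁, r₁⟩, hL₁, hR₁, hk₁⟩ := p
      obtain ⟨⟨l₂, r₂⟩, hL₂, hR₂, hk₂⟩ := q
      refine ⟨fun s t => ?_, fun s t => ?_, fun s t => ?_⟩
      · simp only [ContinuousMap.comp_apply]
        rw [hL₂, hL₁]
      · simp only [ContinuousMap.comp_apply]
        rw [hR₁, hR₂]
      · simp only [ContinuousMap.comp_apply]
        rw [hk₁, hk₂]⟩

end Hull

/-- A family of maps into a compact Hausdorff semigroup is continuous as soon as all its left
multiples are, provided left multiples separate points. -/
theorem continuous_of_forall_continuous_mul_left {S X : Type*} [Semigroup S] [TopologicalSpace S]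
    [ContinuousMul S] [CompactSpace S] [T2Space S] [TopologicalSpace X]
    (hsep : Function.Injective fun x s : S => s * x) {f : X → S}
    (hf : ∀ s, Continuous fun a => s * f a) : Continuous f := by
  have hc : Continuous fun x s : S => s * x := by fun_prop
  exact (hc.isClosedEmbedding hsep).isInducing.continuous_iff.2 (continuous_pi hf)

/-- A family of maps into a compact Hausdorff semigroup is continuous as soon as all its right
multiples are, provided right multiples separate points. -/
theorem continuous_of_forall_continuous_mul_right {S X : Type*} [Semigroup S] [TopologicalSpace S]
    [ContinuousMul S] [CompactSpace S] [T2Space S] [TopologicalSpace X]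
    (hsep : Function.Injective fun x s : S => x * s) {f : X → S}
    (hf : ∀ s, Continuous fun a => f a * s) : Continuous f := by
  have hc : Continuous fun x s : S => x * s := by fun_prop
  exact (hc.isClosedEmbedding hsep).isInducing.continuous_iff.2 (continuous_pi hf)

/-- The linked pairs of (not necessarily continuous) left and right translations. -/
def linkedPairs (S : Type*) [Semigroup S] : Set ((S → S) × (S → S)) :=
  {p | (∀ s t, p.1 (s * t) = p.1 s * t) ∧ (∀ s t, p.2 (s * t) = s * p.2 t) ∧
    ∀ s t, s * p.1 t = p.2 s * t}

theorem isClosed_linkedPairs (S : Type*) [Semigroup S] [TopologicalSpace S] [ContinuousMul S]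
    [T2Space S] : IsClosed (linkedPairs S) := by
  simp only [linkedPairs, Set.ofPred_and, Set.ofPred_forall]
  refine .inter ?_ (.inter ?_ ?_) <;>
    exact isClosed_iInter fun s => isClosed_iInter fun t => isClosed_eq (by fun_prop) (by fun_prop)

theorem continuous_linkedPairs_fst_apply {S : Type*} [Semigroup S] [TopologicalSpace S]
    [ContinuousMul S] [CompactSpace S] [T2Space S]
    (hsep : Function.Injective fun x s : S => s * x) :
    Continuous fun q : linkedPairs S × S => q.1.1.1 q.2 := by
  refine continuous_of_forall_continuous_mul_left hsep fun s => ?_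
  simp only [fun q : linkedPairs S × S => q.1.2.2.2 s q.2]
  fun_prop

theorem continuous_linkedPairs_snd_apply {S : Type*} [Semigroup S] [TopologicalSpace S]
    [ContinuousMul S] [CompactSpace S] [T2Space S]
    (hsep : Function.Injective fun x s : S => x * s) :
    Continuous fun q : linkedPairs S × S => q.1.1.2 q.2 := by
  refine continuous_of_forall_continuous_mul_right hsep fun s => ?_
  simp only [fun q : linkedPairs S × S => (q.1.2.2.2 q.2 s).symm]
  fun_prop

/-- In a compact Hausdorff reductive semigroup, linked pairs with the topology of pointwise
convergence are the same as bitranslations with the compact-open topology. -/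
def translationalHullHomeomorph {S : Type*} [Semigroup S] [TopologicalSpace S]
    [ContinuousMul S] [CompactSpace S] [T2Space S]
    (hl : Function.Injective fun x s : S => x * s) (hr : Function.Injective fun x s : S => s * x) :
    TranslationalHull S ≃ₜ linkedPairs S where
  toFun p := ⟨(p.1.1, p.1.2), p.2⟩
  invFun p := ⟨(⟨p.1.1, (continuous_linkedPairs_fst_apply hr).comp (.prodMk_right p)⟩,
    ⟨p.1.2, (continuous_linkedPairs_snd_apply hl).comp (.prodMk_right p)⟩), p.2⟩
  left_inv _ := rfl
  right_inv _ := rfl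
  continuous_toFun := by
    refine .subtype_mk (.prodMk ?_ ?_) _ <;> exact continuous_pi fun s => by fun_prop
  continuous_invFun := by
    refine .subtype_mk (.prodMk ?_ ?_) _
    · exact ContinuousMap.continuous_of_continuous_uncurry _ (continuous_linkedPairs_fst_apply hr)
    · exact ContinuousMap.continuous_of_continuous_uncurry _ (continuous_linkedPairs_snd_apply hl)

open Topology in
/-- For a compact Hausdorff reductive topological semigroup `S`, the compact-open topology on
the translational hull `Ω(S)` coincides with the topology of pointwise convergence (the
evaluation map into `(S → S) × (S → S)` with the product topologies is inducing), and `Ω(S)`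
is a compact Hausdorff topological semigroup. -/
theorem translationalHull_of_compact_reductive
    {S : Type*} [Semigroup S] [TopologicalSpace S] [ContinuousMul S]
    [CompactSpace S] [T2Space S]
    (hleft : Function.Injective fun s : S =>
      (⟨fun u => s * u, continuous_mul_left s⟩ : C(S, S)))
    (hright : Function.Injective fun s : S =>
      (⟨fun u => u * s, continuous_mul_right s⟩ : C(S, S))) :
    IsInducing (fun p : TranslationalHull S =>
        ((fun s => p.1.1 s, fun s => p.1.2 s) : (S → S) × (S → S))) ∧
      CompactSpace (TranslationalHull S) ∧ T2Space (TranslationalHull S) ∧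
      Continuous (fun p : TranslationalHull S × TranslationalHull S => p.1 * p.2) := by
  have hl : Function.Injective fun x s : S => x * s := fun x y h =>
    hleft (ContinuousMap.ext (congrFun h))
  have hr : Function.Injective fun x s : S => s * x := fun x y h =>
    hright (ContinuousMap.ext (congrFun h))
  let e := translationalHullHomeomorph hl hr
  have : CompactSpace (linkedPairs S) :=
    isCompact_iff_compactSpace.1 (isClosed_linkedPairs S).isCompact
  refine ⟨IsInducing.subtypeVal.comp e.isInducing, e.symm.compactSpace, inferInstance, ?_⟩
  refine .subtype_mk (.prodMk ?_ ?_) _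
  · exact .compCM (by fun_prop) (by fun_prop)
  · exact .compCM (by fun_prop) (by fun_prop)
end

section
/- Let S be a topological semigroup and let I be a closed ideal of S whose subspace topology is locally compact Hausdorff. Then for every s ∈ S the pair (λ^I_s, ρ^I_s) of left and right multiplication by s restricted to I is a bitranslation of I, and the I-representation ω^I : S → Ω(I), s ↦ (λ^I_s, ρ^I_s), is continuous with respect to the compact-open topology on Ω(I). -/
open Filter Topology

/-- Let `S` be a topological semigroup and `I` a closed ideal (a subsemigroup with
`S·I ⊆ I` and `I·S ⊆ I`) whose subspace topology is locally compact Hausdorff. Then for every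
`s : S` the pair of restricted left and right multiplications by `s` is a bitranslation of
`I`, and the resulting `I`-representation `ω : S → Ω(I)` is continuous. -/
theorem ideal_representation_continuous
    {S : Type*} [Semigroup S] [TopologicalSpace S] [ContinuousMul S]
    (I : Subsemigroup S) [LocallyCompactSpace I] [T2Space I]
    (hne : (I : Set S).Nonempty) (hclosed : IsClosed (I : Set S))
    (hl : ∀ s : S, ∀ x ∈ I, s * x ∈ I) (hr : ∀ s : S, ∀ x ∈ I, x * s ∈ I) :
    ∃ ω : S → TranslationalHull I,
      (∀ (s : S) (x : I), (((ω s).1.1 x : I) : S) = s * (x : S) ∧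
        (((ω s).1.2 x : I) : S) = (x : S) * s) ∧
      Continuous ω := by
  let L : C(S, C(I, I)) := ContinuousMap.curry
    ⟨fun p : S × I => ⟨p.1 * p.2, hl p.1 p.2 p.2.2⟩, by fun_prop⟩
  let R : C(S, C(I, I)) := ContinuousMap.curry
    ⟨fun p : S × I => ⟨p.2 * p.1, hr p.1 p.2 p.2.2⟩, by fun_prop⟩
  have hbi (s : S) : IsBitranslation (L s, R s) :=
    ⟨fun x y => Subtype.ext (mul_assoc s (x : S) y).symm,
      fun x y => Subtype.ext (mul_assoc (x : S) y s),
      fun x y => Subtype.ext (mul_assoc (x : S) s y).symm⟩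
  exact ⟨fun s => ⟨(L s, R s), hbi s⟩, fun _ _ => ⟨rfl, rfl⟩,
    (L.continuous.prodMk R.continuous).subtype_mk hbi⟩
end

section
/- Let S be a nonempty compact Hausdorff completely simple topological semigroup. Then the map s ↦ λ_s from S to C(S,S), where λ_s(u) = s·u, is injective if and only if S has plenty of torsion on the left, i.e., for every pair of distinct idempotents e, f ∈ S with e·S = f·S, there exists an idempotent g ∈ S with S·g = S·e such that f·g ≠ e. -/
/-- A semigroup is completely simple if `S·a·S = S` for every `a`, and every element belongs
to a subsemigroup of `S` which is a group. -/
def IsCompletelySimple (S : Type*) [Semigroup S] : Prop :=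
  (∀ a x : S, ∃ u v : S, u * a * v = x) ∧
  ∀ a : S, ∃ G : Set S, a ∈ G ∧ (∀ x ∈ G, ∀ y ∈ G, x * y ∈ G) ∧
    ∃ e ∈ G, (∀ x ∈ G, e * x = x ∧ x * e = x) ∧ ∀ x ∈ G, ∃ y ∈ G, x * y = e ∧ y * x = e

namespace IsCompletelySimple

variable {S : Type*} [Semigroup S]

/-- Every element of a completely simple semigroup has an inverse relative to an idempotent which
is a two-sided identity for it. -/
theorem exists_identity_inverse (hcs : IsCompletelySimple S) (a : S) :
    ∃ e b : S, e * e = e ∧ e * a = a ∧ a * e = a ∧ a * b = e ∧ b * a = e := by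
  obtain ⟨G, ha, -, e, he, hid, hinv⟩ := hcs.2 a
  obtain ⟨b, -, hab, hba⟩ := hinv a ha
  exact ⟨e, b, (hid e he).1, (hid a ha).1, (hid a ha).2, hab, hba⟩

/-- Every idempotent of a completely simple semigroup is primitive. -/
theorem eq_of_idempotent_le (hcs : IsCompletelySimple S) {e k : S} (he : e * e = e)
    (hk : k * k = k) (hek : e * k = k) (hke : k * e = k) : k = e := by
  obtain ⟨u, v, huv⟩ := hcs.1 k e
  have hab : (e * u * k) * (k * v * e) = e := by
    calc (e * u * k) * (k * v * e) = e * (u * (k * k) * v) * e := by simp only [mul_assoc]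
      _ = e := by rw [hk, huv, he, he]
  have hkb : k * (k * v * e) = k * v * e := by rw [← mul_assoc, ← mul_assoc, hk]
  have hbe : (k * v * e) * e = k * v * e := by rw [mul_assoc, he]
  generalize e * u * k = a at hab
  generalize k * v * e = b at hab hkb hbe
  obtain ⟨i, c, -, -, hbi, hbc, hcb⟩ := hcs.exists_identity_inverse b
  have hei : e * i = e := by rw [← hab, mul_assoc, hbi]
  have hki : k * i = i := by rw [← hbc, ← mul_assoc, hkb]
  have hie : e = i := by rw [← hei, ← hki, ← mul_assoc, hek]
  rw [← hke, hie, hki]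

/-- For an idempotent `e` and any `u`, the `ℛ`-class of `u` and the `ℒ`-class of `e` share an
idempotent. -/
theorem exists_idempotent_mul_eq (hcs : IsCompletelySimple S) {e : S} (he : e * e = e) (u : S) :
    ∃ g : S, g * g = g ∧ g * e = g ∧ e * g = e ∧ g * u = u := by
  obtain ⟨j, -, hjj, hju, -, -, -⟩ := hcs.exists_identity_inverse u
  obtain ⟨g, y, hgg, -, -, hy, hy'⟩ := hcs.exists_identity_inverse (u * e)
  have hge : g * e = g := by rw [← hy', mul_assoc, mul_assoc, he]
  have hjg : j * g = g := by rw [← hy, ← mul_assoc, ← mul_assoc, hju]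
  have heg : e * g = e := by
    refine hcs.eq_of_idempotent_le he ?_ ?_ ?_
    · rw [mul_assoc, ← mul_assoc g, hge, hgg]
    · rw [← mul_assoc, he]
    · rw [mul_assoc, hge]
  have hgj : g * j = j := by
    refine hcs.eq_of_idempotent_le hjj ?_ ?_ ?_
    · rw [mul_assoc, ← mul_assoc j, hjg, ← mul_assoc, hgg]
    · rw [← mul_assoc, hjg]
    · rw [mul_assoc, hjj]
  exact ⟨g, hgg, hge, heg, by rw [← hju, ← mul_assoc, hgj]⟩

end IsCompletelySimple

theorem range_mul_left_eq_of_mul_eq {S : Type*} [Semigroup S] {e f : S} (hef : e * f = f)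
    (hfe : f * e = e) : Set.range (fun s : S => e * s) = Set.range (fun s : S => f * s) := by
  ext x
  constructor
  · rintro ⟨s, rfl⟩
    exact ⟨e * s, by simp only [← mul_assoc, hfe]⟩
  · rintro ⟨s, rfl⟩
    exact ⟨f * s, by simp only [← mul_assoc, hef]⟩

theorem range_mul_right_eq_of_mul_eq {S : Type*} [Semigroup S] {e f : S} (hef : e * f = e)
    (hfe : f * e = f) : Set.range (fun s : S => s * e) = Set.range (fun s : S => s * f) := by
  ext x
  constructor
  · rintro ⟨s, rfl⟩
    exact ⟨s * e, by simp only [mul_assoc, hef]⟩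
  · rintro ⟨s, rfl⟩
    exact ⟨s * f, by simp only [mul_assoc, hfe]⟩

/-- In a nonempty compact Hausdorff completely simple topological semigroup, the canonical map
`s ↦ λ_s` into `C(S,S)` is injective if and only if `S` has plenty of torsion on the left:
for all distinct idempotents `e, f` with `e·S = f·S` there is an idempotent `g` with
`S·g = S·e` and `f·g ≠ e`. -/
theorem left_canonical_injective_iff_plenty_of_torsion
    {S : Type*} [Semigroup S] [TopologicalSpace S] [ContinuousMul S]
    [CompactSpace S] [T2Space S] [Nonempty S]
    (hcs : IsCompletelySimple S) :
    Function.Injective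
        (fun s : S => (⟨fun u => s * u, continuous_mul_left s⟩ : C(S, S))) ↔
      ∀ e f : S, e * e = e → f * f = f → e ≠ f →
        Set.range (fun s : S => e * s) = Set.range (fun s : S => f * s) →
        ∃ g : S, g * g = g ∧
          Set.range (fun s : S => s * g) = Set.range (fun s : S => s * e) ∧ f * g ≠ e := by
  constructor
  · intro hinj e f he _ hne _
    by_contra! hcon
    refine hne (hinj (ContinuousMap.ext fun u => ?_))
    obtain ⟨g, hgg, hge, heg, hgu⟩ := hcs.exists_idempotent_mul_eq he u
    have hfg : f * g = e := hcon g hgg (range_mul_right_eq_of_mul_eq hge heg)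
    change e * u = f * u
    rw [← hgu, ← mul_assoc, ← mul_assoc, heg, hfg]
  · intro hplenty s t hst
    have hmul : ∀ u, s * u = t * u := fun u => DFunLike.congr_fun hst u
    by_contra hne
    obtain ⟨e, s', he, hes, hse, hss', hs's⟩ := hcs.exists_identity_inverse s
    obtain ⟨f, t', hf, hft, htf, htt', -⟩ := hcs.exists_identity_inverse t
    have hfe : f * e = e := by rw [← hss', hmul, ← mul_assoc, hft]
    have hef : e * f = f := by rw [← htt', ← hmul, ← mul_assoc, hes]
    have hef_ne : e ≠ f := by
      rintro rfl
      exact hne (by rw [← hse, hmul, htf])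
    obtain ⟨g, hg, hrange, hfg⟩ :=
      hplenty e f he hf hef_ne (range_mul_left_eq_of_mul_eq hef hfe)
    obtain ⟨x, hx⟩ : e ∈ Set.range (fun s : S => s * g) := hrange ▸ ⟨e, he⟩
    have heg : e * g = e := by
      rw [← hx]
      simp only [mul_assoc, hg]
    refine hfg ?_
    calc f * g = s' * (s * (f * g)) := by rw [← mul_assoc s', hs's, ← mul_assoc, hef]
      _ = s' * (s * g) := by rw [hmul, ← mul_assoc t, htf, ← hmul]
      _ = e := by rw [← mul_assoc, hs's, heg]
end

section
/- Let S be a profinite semigroup with minimum ideal K, and assume S is weakly generalized group mapping (WGGM). Then the K-representation ω^K : S → Ω(K), s ↦ (λ^K_s, ρ^K_s), is an embedding of topological semigroups: it is an injective continuous homomorphism that is a homeomorphism onto its image. -/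
open Filter Topology

section

variable {S : Type*} [Semigroup S] [TopologicalSpace S] [ContinuousMul S]

/-- An ideal of a semigroup: a nonempty subset closed under multiplication by arbitrary
elements on both sides. -/
def IsIdeal (I : Set S) : Prop :=
  I.Nonempty ∧ ∀ s : S, ∀ x ∈ I, s * x ∈ I ∧ x * s ∈ I

/-- Left multiplication by `s` restricted to an ideal `K`, as a continuous self-map of `K`. -/
def lamK (K : Subsemigroup S) (hl : ∀ s : S, ∀ x ∈ K, s * x ∈ K) (s : S) : C(K, K) :=
  ⟨fun x => ⟨s * x, hl s x x.2⟩,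
    Continuous.subtype_mk (Continuous.mul continuous_const continuous_subtype_val) _⟩

/-- Right multiplication by `s` restricted to an ideal `K`, as a continuous self-map of `K`. -/
def rhoK (K : Subsemigroup S) (hr : ∀ s : S, ∀ x ∈ K, x * s ∈ K) (s : S) : C(K, K) :=
  ⟨fun x => ⟨x * s, hr s x x.2⟩,
    Continuous.subtype_mk (Continuous.mul continuous_subtype_val continuous_const) _⟩

/-- The `K`-representation `ω^K : S → Ω(K)`, sending `s` to the bitranslation
`(λ^K_s, ρ^K_s)` of the ideal `K`. -/
def omegaK (K : Subsemigroup S) (hl : ∀ s : S, ∀ x ∈ K, s * x ∈ K)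
    (hr : ∀ s : S, ∀ x ∈ K, x * s ∈ K) (s : S) : TranslationalHull K :=
  ⟨(lamK K hl s, rhoK K hr s), by
    refine ⟨fun x y => ?_, fun x y => ?_, fun x y => ?_⟩ <;>
      exact Subtype.ext (by simp [lamK, rhoK, mul_assoc])⟩

end

/-- In a compact Hausdorff semigroup, if `u = a * u * b` with `a`, `b` in a closed subsemigroup `K`,
then `K` contains a left and a right identity of `u`. -/
theorem exists_left_right_identity_of_mul_mul_eq
    {S : Type*} [Semigroup S] [TopologicalSpace S] [ContinuousMul S]
    [CompactSpace S] [T2Space S] {K : Subsemigroup S} (hK : IsClosed (K : Set S))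
    {u a b : S} (ha : a ∈ K) (hb : b ∈ K) (h : a * u * b = u) :
    (∃ f ∈ K, f * u = u) ∧ ∃ e ∈ K, u * e = u := by
  let P : Set (S × Sᵐᵒᵖ) := {p | p.1 ∈ K ∧ p.2.unop ∈ K ∧ p.1 * u * p.2.unop = u}
  have hP : IsClosed P :=
    (hK.preimage continuous_fst).inter
      ((hK.preimage (MulOpposite.continuous_unop.comp continuous_snd)).inter
        (isClosed_eq ((continuous_fst.mul continuous_const).mul
          (MulOpposite.continuous_unop.comp continuous_snd)) continuous_const))
  obtain ⟨⟨f, e⟩, ⟨hf, he, hfe⟩, hidem⟩ :=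
    exists_idempotent_in_compact_subsemigroup (M := S × Sᵐᵒᵖ)
      (fun r => continuous_id.mul continuous_const) P ⟨(a, MulOpposite.op b), ha, hb, h⟩
      hP.isCompact (by
        rintro ⟨f, e⟩ ⟨hf, he, hfe⟩ ⟨f', e'⟩ ⟨hf', he', hfe'⟩
        refine ⟨K.mul_mem hf hf', K.mul_mem he' he, ?_⟩
        calc f * f' * u * (e'.unop * e.unop) = f * (f' * u * e'.unop) * e.unop := by
              simp only [mul_assoc]
          _ = u := by rw [hfe', hfe])
  have hff : f * f = f := congrArg Prod.fst hidem
  have hee : e.unop * e.unop = e.unop := congrArg (fun p => p.2.unop) hidem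
  dsimp only at hf he hfe
  refine ⟨⟨f, hf, ?_⟩, e.unop, he, ?_⟩
  · calc f * u = f * f * u * e.unop := by rw [mul_assoc f f u, mul_assoc f, hfe]
      _ = u := by rw [hff, hfe]
  · calc u * e.unop = f * u * (e.unop * e.unop) := by rw [← mul_assoc, hfe]
      _ = u := by rw [hee, hfe]

/-- Every element of a closed minimum ideal `K` of a compact Hausdorff semigroup has a left and a
right identity in `K`. -/
theorem exists_left_right_identity_of_mem_minimum_ideal
    {S : Type*} [Semigroup S] [TopologicalSpace S] [ContinuousMul S]
    [CompactSpace S] [T2Space S] {K : Subsemigroup S} (hKideal : IsIdeal (K : Set S))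
    (hKclosed : IsClosed (K : Set S)) (hKmin : ∀ J : Set S, IsIdeal J → (K : Set S) ⊆ J)
    {u : S} (hu : u ∈ K) :
    (∃ f ∈ K, f * u = u) ∧ ∃ e ∈ K, u * e = u := by
  have hJ : IsIdeal {x : S | ∃ a ∈ K, ∃ b ∈ K, a * u * b = x} := by
    refine ⟨⟨_, u, hu, u, hu, rfl⟩, ?_⟩
    rintro s _ ⟨a, ha, b, hb, rfl⟩
    exact ⟨⟨s * a, (hKideal.2 s a ha).1, b, hb, by simp only [mul_assoc]⟩,
      ⟨a, ha, b * s, (hKideal.2 s b hb).2, by simp only [mul_assoc]⟩⟩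
  obtain ⟨a, ha, b, hb, h⟩ := hKmin _ hJ hu
  exact exists_left_right_identity_of_mul_mul_eq hKclosed ha hb h

theorem continuous_omegaK
    {S : Type*} [Semigroup S] [TopologicalSpace S] [ContinuousMul S] (K : Subsemigroup S)
    (hl : ∀ s : S, ∀ x ∈ K, s * x ∈ K) (hr : ∀ s : S, ∀ x ∈ K, x * s ∈ K) :
    Continuous (omegaK K hl hr) := by
  refine Continuous.subtype_mk (Continuous.prodMk ?_ ?_) _
  · refine ContinuousMap.continuous_of_continuous_uncurry _ (Continuous.subtype_mk ?_ _)
    exact continuous_fst.mul (continuous_subtype_val.comp continuous_snd)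
  · refine ContinuousMap.continuous_of_continuous_uncurry _ (Continuous.subtype_mk ?_ _)
    exact (continuous_subtype_val.comp continuous_snd).mul continuous_fst

open Topology in
/-- If a profinite semigroup `S` with minimum closed ideal `K` is weakly generalized group
mapping (WGGM), then the `K`-representation `ω^K : S → Ω(K)` is an embedding of topological
semigroups: an injective continuous multiplicative map which is a homeomorphism onto its
image. -/
theorem omegaK_embedding_of_wggm
    {S : Type*} [Semigroup S] [TopologicalSpace S] [ContinuousMul S]
    [CompactSpace S] [T2Space S] [TotallyDisconnectedSpace S]
    (K : Subsemigroup S) (hKideal : IsIdeal (K : Set S)) (hKclosed : IsClosed (K : Set S))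
    (hKmin : ∀ J : Set S, IsIdeal J → (K : Set S) ⊆ J)
    (hl : ∀ s : S, ∀ x ∈ K, s * x ∈ K) (hr : ∀ s : S, ∀ x ∈ K, x * s ∈ K)
    (hwggm : ∀ u v : S, u ≠ v →
      (lamK K hl u ≠ lamK K hl v ∧ rhoK K hr u ≠ rhoK K hr v) ∨ (u ∈ K ∧ v ∈ K)) :
    Function.Injective (omegaK K hl hr) ∧ Continuous (omegaK K hl hr) ∧
      (∀ s t : S, omegaK K hl hr (s * t) = omegaK K hl hr s * omegaK K hl hr t) ∧
      IsEmbedding (omegaK K hl hr) := by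
  have hinj : Function.Injective (omegaK K hl hr) := by
    intro u v huv
    have hlam : lamK K hl u = lamK K hl v := congrArg (fun p => p.1.1) huv
    have hrho : rhoK K hr u = rhoK K hr v := congrArg (fun p => p.1.2) huv
    by_contra hne
    rcases hwggm u v hne with h | ⟨hu, hv⟩
    · exact h.1 hlam
    obtain ⟨-, e, he, hue⟩ :=
      exists_left_right_identity_of_mem_minimum_ideal hKideal hKclosed hKmin hu
    obtain ⟨⟨f, hf, hfv⟩, -⟩ :=
      exists_left_right_identity_of_mem_minimum_ideal hKideal hKclosed hKmin hv
    have hve : u * e = v * e := congrArg Subtype.val (DFunLike.congr_fun hlam (⟨e, he⟩ : K))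
    have hfu : f * u = f * v := congrArg Subtype.val (DFunLike.congr_fun hrho (⟨f, hf⟩ : K))
    apply hne
    calc u = f * v * e := by rw [hfv, ← hve, hue]
      _ = f * u := by rw [← hfu, mul_assoc, hue]
      _ = v := by rw [hfu, hfv]
  have hcont := continuous_omegaK K hl hr
  refine ⟨hinj, hcont, fun s t => ?_, (hcont.isClosedEmbedding hinj).isEmbedding⟩
  refine Subtype.ext (Prod.ext ?_ ?_) <;> ext x
  · exact mul_assoc s t x
  · exact (mul_assoc (x : S) s t).symm
end

section
/- Let A and B be nonempty topological spaces and let S = A × B be the rectangular band with multiplication (a,b)·(a',b') = (a,b') and the product topology. Then the map sending a pair (φ,ψ) ∈ C(A,A) × C(B,B) to the pair (λ,ρ) of maps of S given by λ(a,b) = (φ(a), b) and ρ(a,b) = (a, ψ(b)) is a bijection onto the translational hull Ω(S); it is a homeomorphism with respect to the compact-open topologies, and it carries the multiplication (φ₁,ψ₁)*(φ₂,ψ₂) = (φ₁∘φ₂, ψ₂∘ψ₁) on C(A,A) × C(B,B) to the multiplication of Ω(S). -/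
open Filter Topology

/-- The rectangular band on `A × B`: multiplication `(a,b)·(a',b') = (a,b')`. -/
abbrev RectBand (A B : Type*) := A × B

instance {A B : Type*} : Semigroup (RectBand A B) where
  mul x y := (x.1, y.2)
  mul_assoc _ _ _ := rfl

instance {A B : Type*} [TopologicalSpace A] [TopologicalSpace B] :
    ContinuousMul (RectBand A B) :=
  ⟨by
    show Continuous fun p : (A × B) × (A × B) => ((p.1.1, p.2.2) : A × B)
    fun_prop⟩

/-- Pairing with a fixed continuous map is continuous in the compact-open topology, without any
separation or local compactness assumption. -/
theorem ContinuousMap.continuous_prodMk_const_right {X Y Z : Type*} [TopologicalSpace X]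
    [TopologicalSpace Y] [TopologicalSpace Z] (g : C(X, Z)) :
    Continuous fun f : C(X, Y) => f.prodMk g := by
  classical
  rw [ContinuousMap.continuous_compactOpen]
  intro K hK U hU
  rw [isOpen_iff_mem_nhds]
  intro f hf
  have hbox : ∀ x ∈ K, ∃ V : Set Y, ∃ W : Set Z, IsOpen V ∧ IsOpen W ∧ f x ∈ V ∧ g x ∈ W ∧
      V ×ˢ W ⊆ U := fun x hx => isOpen_prod_iff.1 hU (f x) (g x) (hf hx)
  choose! V W hV hW hfV hgW hVW using hbox
  obtain ⟨t, htK, ht⟩ := hK.elim_nhds_subcover (fun x => f ⁻¹' V x ∩ g ⁻¹' W x) fun x hx =>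
    (((hV x hx).preimage f.continuous).inter ((hW x hx).preimage g.continuous)).mem_nhds
      ⟨hfV x hx, hgW x hx⟩
  -- The points of `K` whose second coordinate lies only in boxes indexed by `J`.
  let L (J : Finset X) : Set X := K ∩ ⋂ i ∈ t \ J, (g ⁻¹' W i)ᶜ
  have hL (J : Finset X) : IsCompact (L J) :=
    hK.inter_right <| isClosed_biInter fun i hi =>
      ((hW i (htK i (Finset.mem_sdiff.1 hi).1)).preimage g.continuous).isClosed_compl
  have hnhds : ∀ J ∈ t.powerset,
      ∀ᶠ h : C(X, Y) in 𝓝 f, Set.MapsTo h (L J) (⋃ i ∈ J, V i) := by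
    intro J hJ
    refine ContinuousMap.eventually_mapsTo (hL J)
      (isOpen_biUnion fun i hi => hV i (htK i (Finset.mem_powerset.1 hJ hi))) ?_
    rintro x ⟨hxK, hx⟩
    obtain ⟨i, hi, hfi, hgi⟩ := Set.mem_iUnion₂.1 (ht hxK)
    refine Set.mem_iUnion₂.2 ⟨i, ?_, hfi⟩
    by_contra hiJ
    exact Set.mem_iInter₂.1 hx i (Finset.mem_sdiff.2 ⟨hi, hiJ⟩) hgi
  filter_upwards [(Finset.eventually_all _).2 hnhds] with h hh x hx
  obtain ⟨i, hi, hhi⟩ := Set.mem_iUnion₂.1 <|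
    hh (t.filter fun i => g x ∈ W i) (Finset.mem_powerset.2 (Finset.filter_subset _ _))
      (show x ∈ L _ from ⟨hx, Set.mem_iInter₂.2 fun i hi hgi =>
        (Finset.mem_sdiff.1 hi).2 (Finset.mem_filter.2 ⟨(Finset.mem_sdiff.1 hi).1, hgi⟩)⟩)
  obtain ⟨hit, hgi⟩ := Finset.mem_filter.1 hi
  exact hVW i (htK i hit) ⟨hhi, hgi⟩

/-- Pairing with a fixed continuous map on the left is continuous in the compact-open topology. -/
theorem ContinuousMap.continuous_prodMk_const_left {X Y Z : Type*} [TopologicalSpace X]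
    [TopologicalSpace Y] [TopologicalSpace Z] (f : C(X, Y)) :
    Continuous fun g : C(X, Z) => f.prodMk g :=
  (ContinuousMap.continuous_postcomp (ContinuousMap.prodSwap : C(Z × Y, Y × Z))).comp
    (ContinuousMap.continuous_prodMk_const_right f)

namespace RectBand

variable {A B : Type*} [TopologicalSpace A] [TopologicalSpace B]

/-- The bitranslation `((a, b) ↦ (φ a, b), (a, b) ↦ (a, ψ b))` of a rectangular band. -/
def bitranslation (p : C(A, A) × C(B, B)) : TranslationalHull (RectBand A B) :=
  ⟨((p.1.comp ContinuousMap.fst).prodMk ContinuousMap.snd,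
    ContinuousMap.fst.prodMk (p.2.comp ContinuousMap.snd)),
    fun _ _ => rfl, fun _ _ => rfl, fun _ _ => rfl⟩

theorem continuous_bitranslation :
    Continuous (bitranslation : C(A, A) × C(B, B) → TranslationalHull (RectBand A B)) :=
  Continuous.subtype_mk
    (Continuous.prodMk
      ((ContinuousMap.continuous_prodMk_const_right _).comp
        ((ContinuousMap.continuous_precomp _).comp continuous_fst))
      ((ContinuousMap.continuous_prodMk_const_left _).comp
        ((ContinuousMap.continuous_precomp _).comp continuous_snd))) _

/-- The components of a bitranslation of a rectangular band, read off along the slices through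
`(a₀, b₀)`. -/
def components (a₀ : A) (b₀ : B) (p : TranslationalHull (RectBand A B)) : C(A, A) × C(B, B) :=
  (ContinuousMap.fst.comp (p.1.1.comp ((ContinuousMap.id A).prodMk (ContinuousMap.const A b₀))),
    ContinuousMap.snd.comp (p.1.2.comp ((ContinuousMap.const B a₀).prodMk (ContinuousMap.id B))))

theorem continuous_components (a₀ : A) (b₀ : B) : Continuous (components a₀ b₀) :=
  Continuous.prodMk
    ((ContinuousMap.continuous_postcomp _).comp ((ContinuousMap.continuous_precomp _).comp
      (continuous_fst.comp continuous_subtype_val)))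
    ((ContinuousMap.continuous_postcomp _).comp ((ContinuousMap.continuous_precomp _).comp
      (continuous_snd.comp continuous_subtype_val)))

theorem bitranslation_components (a₀ : A) (b₀ : B) (p : TranslationalHull (RectBand A B)) :
    bitranslation (components a₀ b₀ p) = p := by
  obtain ⟨⟨l, r⟩, hl, hr, hlr⟩ := p
  refine Subtype.ext (Prod.ext (ContinuousMap.ext ?_) (ContinuousMap.ext ?_))
  · rintro ⟨a, b⟩
    exact Prod.ext (congrArg Prod.fst (hl (a, b₀) (a, b))).symm
      (congrArg Prod.snd (hlr (a, b) (a, b))).symm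
  · rintro ⟨a, b⟩
    have hfst := congrArg Prod.fst (hlr (a, b) (a, b))
    exact Prod.ext hfst
      (congrArg Prod.snd (hr (a, b) (a₀, b))).symm

/-- The translational hull of a rectangular band is homeomorphic to `C(A, A) × C(B, B)`. -/
def homeomorphTranslationalHull (a₀ : A) (b₀ : B) :
    (C(A, A) × C(B, B)) ≃ₜ TranslationalHull (RectBand A B) where
  toFun := bitranslation
  invFun := components a₀ b₀
  left_inv _ := rfl
  right_inv := bitranslation_components a₀ b₀
  continuous_toFun := continuous_bitranslation
  continuous_invFun := continuous_components a₀ b₀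

end RectBand

/-- For a rectangular band `S = A × B` over nonempty spaces, the translational hull `Ω(S)` is
canonically isomorphic to `C(A,A) × C(B,B)`: the map `(φ,ψ) ↦ (λ,ρ)` with `λ(a,b) = (φ a, b)`
and `ρ(a,b) = (a, ψ b)` is a homeomorphism onto `Ω(S)` (compact-open topologies) carrying the
multiplication `(φ₁,ψ₁)*(φ₂,ψ₂) = (φ₁∘φ₂, ψ₂∘ψ₁)` to that of `Ω(S)`. -/
theorem rectBand_translationalHull
    {A B : Type*} [TopologicalSpace A] [TopologicalSpace B] [Nonempty A] [Nonempty B] :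
    ∃ e : (C(A, A) × C(B, B)) ≃ₜ TranslationalHull (RectBand A B),
      (∀ (φ : C(A, A)) (ψ : C(B, B)) (a : A) (b : B),
        (e (φ, ψ)).1.1 (a, b) = ((φ a, b) : RectBand A B) ∧
        (e (φ, ψ)).1.2 (a, b) = ((a, ψ b) : RectBand A B)) ∧
      ∀ p q : C(A, A) × C(B, B), e (p.1.comp q.1, q.2.comp p.2) = e p * e q := by
  obtain ⟨a₀⟩ := ‹Nonempty A›
  obtain ⟨b₀⟩ := ‹Nonempty B›
  exact ⟨RectBand.homeomorphTranslationalHull a₀ b₀, fun _ _ _ _ => ⟨rfl, rfl⟩, fun _ _ => rfl⟩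
end

section
/- Let A be a type (an alphabet), let w be a word over A (a finite list of letters), and let a, b ∈ A be distinct letters. Then there exists a word t over A such that: (i) the word a·w is a suffix of w·t; (ii) the only occurrence of a·w as a factor of w·t is as that suffix, i.e., whenever w·t = x·(a·w)·y for words x, y, the word y is empty; and (iii) b·w is not a factor of w·t, i.e., there are no words x, y with w·t = x·(b·w)·y. -/
/-- A letter `b ≠ a` cannot precede an occurrence of `w` in `w·aⁿ⁺¹·w`, where `n = |w|`. -/
theorem append_replicate_append_ne {A : Type*} (w : List A) {a b : A} (hab : a ≠ b)
    (x y : List A) :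
    w ++ (List.replicate (w.length + 1) a ++ w) ≠ x ++ (b :: w) ++ y := by
  intro h
  have hlen := congrArg List.length h
  simp only [List.length_append, List.length_replicate, List.length_cons] at hlen
  -- Within the first `2n + 1` positions, the letter `b` occurs only in the initial copy of `w`.
  have initial (i : ℕ) (hi : i ≤ 2 * w.length)
      (hb : (x ++ (b :: w) ++ y)[i]? = some b) : i < w.length ∧ w[i]? = some b := by
    rw [← h] at hb
    by_cases hiw : i < w.length
    · rw [List.getElem?_append_left hiw] at hb
      exact ⟨hiw, hb⟩
    · rw [List.getElem?_append_right (by omega), List.getElem?_append_left (by simp; omega),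
        List.getElem?_replicate_of_lt (by omega)] at hb
      exact absurd (Option.some.inj hb) hab
  obtain ⟨hx, hxb⟩ := initial x.length (by omega) (by simp)
  -- Each `b` in `w` forces another one `|x| + 1` positions later.
  have ascent (d : ℕ) : ∀ i < w.length, w.length - i ≤ d → w[i]? ≠ some b := by
    induction d with
    | zero => omega
    | succ d ih =>
      intro i hi hd hb
      obtain ⟨hlt, hb'⟩ := initial (x.length + (i + 1)) (by omega) (by
        rw [List.append_assoc, List.getElem?_append_right (by omega), Nat.add_sub_cancel_left,
          List.cons_append, List.getElem?_cons_succ, List.getElem?_append_left hi, hb])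
      exact ih _ hlt (by omega) hb'
  exact ascent _ _ hx le_rfl hxb

/-- de Bruijn connectivity lemma: for every word `w` and distinct letters `a ≠ b`, there is a
word `t` such that `a·w` occurs in `w·t` exactly once, namely as a suffix, and `b·w` does not
occur in `w·t` at all. -/
theorem exists_word_unique_suffix_occurrence {A : Type*} (w : List A) (a b : A)
    (hab : a ≠ b) :
    ∃ t : List A,
      (∃ x : List A, w ++ t = x ++ (a :: w)) ∧
      (∀ x y : List A, w ++ t = x ++ (a :: w) ++ y → y = []) ∧
      (∀ x y : List A, w ++ t ≠ x ++ (b :: w) ++ y) := by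
  -- Take `t` of minimal length satisfying the first and last conditions.
  let S : Set (List A) := {t | (∃ x : List A, w ++ t = x ++ (a :: w)) ∧
    ∀ x y : List A, w ++ t ≠ x ++ (b :: w) ++ y}
  have hS : S.Nonempty := by
    refine ⟨List.replicate (w.length + 1) a ++ w, ⟨w ++ List.replicate w.length a, ?_⟩,
      append_replicate_append_ne w hab⟩
    simp [List.replicate_succ']
  obtain ⟨t, ⟨hsuffix, hb⟩, hmin⟩ :=
    exists_minimalFor_of_wellFoundedLT (· ∈ S) List.length hS
  refine ⟨t, hsuffix, fun x y h => ?_, hb⟩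
  have hlen := congrArg List.length h
  simp only [List.length_append, List.length_cons] at hlen
  obtain ⟨u, rfl⟩ : y <:+ t :=
    List.suffix_of_suffix_length_le (List.suffix_append_of_suffix (List.suffix_refl y))
      (h ▸ List.suffix_append w t) (by omega)
  rw [← List.append_assoc] at h
  have hu : u ∈ S := ⟨⟨x, List.append_cancel_right h⟩, fun x' y' h' =>
    hb x' (y' ++ y) (by rw [← List.append_assoc, h']; simp)⟩
  have hle := hmin hu (by simp)
  exact List.length_eq_zero_iff.mp (by simpa using hle)
end

section
/- Let S be a profinite semigroup with at least two elements, with minimum ideal K, and assume S is generalized group mapping (GGM), i.e., both maps s ↦ λ^K_s and s ↦ ρ^K_s are injective on S. Then S is unorderable: every closed stable partial order on S is trivial. -/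
/-- In a compact semigroup, an element `y` that is `𝓙`-below `y * s` is `𝓡`-below it. -/
theorem exists_eq_mul_mul_of_eq_mul_mul_mul
    {S : Type*} [Semigroup S] [TopologicalSpace S] [ContinuousMul S]
    [CompactSpace S] [T2Space S] {y s : S} (h : ∃ c d, y = c * (y * s) * d) :
    ∃ d, y = y * s * d := by
  obtain ⟨c, d, hcd⟩ := h
  have hA : IsClosed {b : S | ∃ a, y = a * y * b} := by
    have hc : IsCompact {p : S × S | y = p.1 * y * p.2} :=
      (isClosed_eq continuous_const (by fun_prop)).isCompact
    convert (hc.image continuous_snd).isClosed using 1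
    ext b
    simp
  have hR : IsClosed (Set.range (s * ·)) := (isCompact_range (by fun_prop)).isClosed
  obtain ⟨e, ⟨⟨a, ha⟩, ⟨d', rfl⟩⟩, he⟩ := exists_idempotent_in_compact_subsemigroup
    (fun x : S => by fun_prop) ({b : S | ∃ a, y = a * y * b} ∩ Set.range (s * ·))
    ⟨s * d, ⟨c, by simpa only [mul_assoc] using hcd⟩, d, rfl⟩
    (hA.inter hR).isCompact
    (by
      rintro b ⟨⟨a, ha⟩, ⟨t, rfl⟩⟩ b' ⟨⟨a', ha'⟩, -⟩
      refine ⟨⟨a' * a, ?_⟩, t * b', (mul_assoc s t b').symm⟩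
      calc y = a' * (a * y * (s * t)) * b' := by rw [← ha, ← ha']
        _ = _ := by simp only [mul_assoc])
  refine ⟨d', ?_⟩
  have hye : y * (s * d') = y := by
    calc y * (s * d') = a * y * (s * d') * (s * d') := by rw [← ha]
      _ = a * y * (s * d') := by rw [mul_assoc (a * y), he]
      _ = y := ha.symm
  rw [mul_assoc, hye]

/-- In a compact semigroup, an element `y` that is `𝓙`-below `s * y` is `𝓛`-below it. -/
theorem exists_eq_mul_mul_of_eq_mul_mul_mul'
    {S : Type*} [Semigroup S] [TopologicalSpace S] [ContinuousMul S]
    [CompactSpace S] [T2Space S] {y s : S} (h : ∃ c d, y = c * (s * y) * d) :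
    ∃ d, y = d * (s * y) := by
  obtain ⟨c, d, hcd⟩ := h
  obtain ⟨w, hw⟩ := exists_eq_mul_mul_of_eq_mul_mul_mul (S := Sᵐᵒᵖ)
    (y := MulOpposite.op y) (s := MulOpposite.op s)
    ⟨MulOpposite.op d, MulOpposite.op c, MulOpposite.unop_injective (by
      simpa only [MulOpposite.unop_mul, MulOpposite.unop_op, mul_assoc] using hcd)⟩
  exact ⟨w.unop, congrArg MulOpposite.unop hw⟩

/-- An element of the minimum ideal lies in the two-sided ideal `S z S` for every `z`. -/
theorem exists_eq_mul_mul_of_mem_minimum_ideal {S : Type*} [Semigroup S] {K : Set S}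
    (hKmin : ∀ J : Set S, IsIdeal J → K ⊆ J) {y : S} (hy : y ∈ K) (z : S) :
    ∃ c d, y = c * z * d := by
  refine hKmin {y | ∃ c d, y = c * z * d} ⟨⟨z * z * z, z, z, rfl⟩, ?_⟩ hy
  rintro s _ ⟨c, d, rfl⟩
  exact ⟨⟨s * c, d, by simp only [mul_assoc]⟩, c, d * s, by simp only [mul_assoc]⟩

/-- A nontrivial GGM profinite semigroup is unorderable: every closed stable partial order on
it is trivial. -/
theorem ggm_profinite_semigroup_unorderable
    {S : Type*} [Semigroup S] [TopologicalSpace S] [ContinuousMul S]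
    [CompactSpace S] [T2Space S] [TotallyDisconnectedSpace S] [Nontrivial S]
    (K : Subsemigroup S) (hKideal : IsIdeal (K : Set S)) (hKclosed : IsClosed (K : Set S))
    (hKmin : ∀ J : Set S, IsIdeal J → (K : Set S) ⊆ J)
    (hl : ∀ s : S, ∀ x ∈ K, s * x ∈ K) (hr : ∀ s : S, ∀ x ∈ K, x * s ∈ K)
    (hggm_left : Function.Injective (lamK K hl))
    (hggm_right : Function.Injective (rhoK K hr))
    (r : S → S → Prop)
    (hrefl : ∀ a, r a a)
    (hantisymm : ∀ a b, r a b → r b a → a = b)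
    (htrans : ∀ a b c, r a b → r b c → r a c)
    (hstable : ∀ a b c, r a b → r (c * a) (c * b) ∧ r (a * c) (b * c))
    (hclosed : IsClosed {p : S × S | r p.1 p.2}) :
    ∀ a b, r a b → a = b := by
  intro a b hab
  refine hggm_left (ContinuousMap.ext fun x => Subtype.ext ?_)
  change a * (x : S) = b * x
  refine hggm_right (ContinuousMap.ext fun y => Subtype.ext ?_)
  change (y : S) * (a * x) = y * (b * x)
  have hpq : r (y * (a * x)) (y * (b * x)) := (hstable _ _ _ (hstable _ _ _ hab).2).1
  refine hantisymm _ _ hpq ?_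
  obtain ⟨w, hw⟩ := exists_eq_mul_mul_of_eq_mul_mul_mul
    (exists_eq_mul_mul_of_mem_minimum_ideal hKmin y.2 (y * (a * x)))
  generalize hp : (y : S) * (a * x) = p at hpq hw ⊢
  generalize hq : (y : S) * (b * x) = q at hpq ⊢
  have hR : IsClosed (Set.range (· * (x : S))) := (isCompact_range (by fun_prop)).isClosed
  have hB : IsClosed {v : S | r q (p * v)} :=
    hclosed.preimage (f := fun v : S => (q, p * v)) (by fun_prop)
  obtain ⟨e, ⟨hqe, ⟨z, hz⟩⟩, he⟩ := exists_idempotent_in_compact_subsemigroup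
    (fun x : S => by fun_prop) ({v : S | r q (p * v)} ∩ Set.range (· * (x : S)))
    ⟨w * b * x, by
      have hpu : p * (w * b * x) = q := by
        rw [← hq, ← mul_assoc, ← mul_assoc, ← hw, mul_assoc]
      exact ⟨by simpa only [Set.mem_ofPred_eq, hpu] using hrefl q, w * b, rfl⟩⟩
    (hB.inter hR).isCompact
    (by
      rintro v ⟨hv, -⟩ v' ⟨hv', ⟨t, rfl⟩⟩
      refine ⟨htrans _ _ _ hv' ?_, v * t, mul_assoc v t x⟩
      rw [← mul_assoc p v]
      exact (hstable _ _ _ (htrans _ _ _ hpq hv)).2)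
  obtain ⟨d, hd⟩ := exists_eq_mul_mul_of_eq_mul_mul_mul'
    (exists_eq_mul_mul_of_mem_minimum_ideal hKmin x.2 (z * x))
  have hz' : z * (x : S) = e := hz
  have hxe : (x : S) * e = x := by
    rw [hz'] at hd
    rw [hd, mul_assoc, he]
  have hpe : p * e = p := by
    rw [← hp, mul_assoc, mul_assoc, hxe]
  rwa [Set.mem_ofPred_eq, hpe] at hqe
end

section
/- Let S be a profinite semigroup with at least two elements, with minimum ideal K, and assume S is generalized group mapping (GGM), i.e., both maps s ↦ λ^K_s and s ↦ ρ^K_s are injective on S. Then: (i) for all distinct s, t ∈ S there exist x, y ∈ K with x·s·y ≠ x·t·y; and (ii) every maximal subgroup of K is nontrivial, i.e., for every idempotent e ∈ K there exists x ∈ K with x ≠ e, x·e = e·x = x, and x·y = y·x = e for some y ∈ K. -/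
/-- A compact Hausdorff local monoid `eSe` is Dedekind finite: one-sided inverses in it are
two-sided. -/
theorem mul_eq_idempotent_symm {S : Type*} [Semigroup S] [TopologicalSpace S] [ContinuousMul S]
    [CompactSpace S] [T2Space S] {e a y : S} (he : e * e = e) (hae : a * e = a)
    (hey : e * y = y) (hye : y * e = y) (hay : a * y = e) : y * a = e := by
  let P : Set (S × S × S) := {p | p.1 = y * p.2.1 ∧ e * p.2.1 = p.2.1 ∧ p.2.2 * p.1 = e}
  have hP : IsClosed P :=
    (isClosed_eq (by fun_prop) (by fun_prop)).inter <|
      (isClosed_eq (by fun_prop) (by fun_prop)).inter <|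
        isClosed_eq (by fun_prop) (by fun_prop)
  obtain ⟨f, ⟨⟨_, m, c⟩, ⟨hm, hem, hc⟩, rfl⟩, hf⟩ :=
    exists_idempotent_in_compact_subsemigroup (fun r : S => continuous_mul_const r)
      (Prod.fst '' P) ⟨y, (y, e, a), ⟨hye.symm, he, hay⟩, rfl⟩
      (hP.isCompact.image continuous_fst) (by
        rintro _ ⟨⟨z, m, c⟩, ⟨hz, hem, hc⟩, rfl⟩ _ ⟨⟨w, n, d⟩, ⟨hw, -, hd⟩, rfl⟩
        dsimp only at *
        subst hz hw
        refine ⟨(y * m * (y * n), m * (y * n), d * c), ⟨?_, ?_, ?_⟩, rfl⟩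
        · simp only [mul_assoc]
        · rw [← mul_assoc, hem]
        · calc d * c * (y * m * (y * n)) = d * ((c * (y * m)) * y * n) := by
                simp only [mul_assoc]
            _ = e := by rw [hc, hey, hd])
  dsimp only at *
  subst hm
  have hf1 : y * m = e := by
    calc y * m = e * (y * m) := by rw [← mul_assoc, hey]
      _ = c * ((y * m) * (y * m)) := by rw [← hc]; simp only [mul_assoc]
      _ = e := by rw [hf, hc]
  have ham : a = m := by rw [← hae, ← hf1, ← mul_assoc, hay, hem]
  rw [ham, hf1]

/-- If an idempotent `e` of a compact Hausdorff semigroup is a multiple of `x ∈ eSe`, then `x`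
is invertible in `eSe`. -/
theorem exists_local_inverse_of_eq_mul_mul {S : Type*} [Semigroup S] [TopologicalSpace S]
    [ContinuousMul S] [CompactSpace S] [T2Space S] {e x a b : S} (he : e * e = e)
    (hex : e * x = x) (hxe : x * e = x) (h : a * x * b = e) :
    ∃ z, e * z = z ∧ x * z = e ∧ z * x = e := by
  have he' : ∀ u, e * (e * u) = e * u := fun u => by rw [← mul_assoc, he]
  have hex' : ∀ u, e * (x * u) = x * u := fun u => by rw [← mul_assoc, hex]
  have hxe' : ∀ u, x * (e * u) = x * u := fun u => by rw [← mul_assoc, hxe]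
  have h1 : (x * (e * b * e)) * (e * a * e) = e := by
    apply mul_eq_idempotent_symm he <;> simp only [mul_assoc, he, hex', hxe']
    rw [mul_assoc] at h
    calc e * (a * (x * (b * e))) = e * (a * (x * b)) * e := by simp only [mul_assoc]
      _ = e := by rw [h, he, he]
  have h2 : (e * b * e) * (e * a * e) * x = e := by
    apply mul_eq_idempotent_symm he hxe
    · simp only [mul_assoc, he']
    · simp only [mul_assoc, he]
    · rw [← mul_assoc, h1]
  exact ⟨(e * b * e) * (e * a * e), by simp only [mul_assoc, he'], by rw [← mul_assoc, h1], h2⟩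

/-- The set `SxS` is an ideal. -/
theorem isIdeal_setOf_mul_mul {S : Type*} [Semigroup S] [TopologicalSpace S] [ContinuousMul S]
    (x : S) : IsIdeal {z : S | ∃ a b, a * x * b = z} := by
  refine ⟨⟨x * x * x, x, x, rfl⟩, ?_⟩
  rintro s _ ⟨a, b, rfl⟩
  exact ⟨⟨s * a, b, by simp only [mul_assoc]⟩, ⟨a, b * s, by simp only [mul_assoc]⟩⟩

/-- In a nontrivial GGM profinite semigroup with minimum ideal `K`: (i) distinct elements can
be separated by two-sided multiplication by elements of `K`; (ii) every maximal subgroup of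
`K` is nontrivial, i.e. for every idempotent `e ∈ K` there is `x ∈ K` distinct from `e` with
`x·e = e·x = x` and `x·y = y·x = e` for some `y ∈ K`. -/
theorem ggm_profinite_semigroup_separation_and_nontrivial_subgroups
    {S : Type*} [Semigroup S] [TopologicalSpace S] [ContinuousMul S]
    [CompactSpace S] [T2Space S] [TotallyDisconnectedSpace S] [Nontrivial S]
    (K : Subsemigroup S) (hKideal : IsIdeal (K : Set S)) (hKclosed : IsClosed (K : Set S))
    (hKmin : ∀ J : Set S, IsIdeal J → (K : Set S) ⊆ J)
    (hl : ∀ s : S, ∀ x ∈ K, s * x ∈ K) (hr : ∀ s : S, ∀ x ∈ K, x * s ∈ K)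
    (hggm_left : Function.Injective (lamK K hl))
    (hggm_right : Function.Injective (rhoK K hr)) :
    (∀ s t : S, s ≠ t → ∃ x ∈ K, ∃ y ∈ K, x * s * y ≠ x * t * y) ∧
      ∀ e : S, e ∈ K → e * e = e →
        ∃ x ∈ K, x ≠ e ∧ x * e = x ∧ e * x = x ∧ ∃ y ∈ K, x * y = e ∧ y * x = e := by
  have hsep : ∀ s t : S, s ≠ t → ∃ x ∈ K, ∃ y ∈ K, x * s * y ≠ x * t * y := by
    intro s t hst
    by_contra! hxy
    refine hst (hggm_left (ContinuousMap.ext fun y => Subtype.ext ?_))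
    have hy : rhoK K hr (s * y) = rhoK K hr (t * y) :=
      ContinuousMap.ext fun x => Subtype.ext <| by
        simpa only [rhoK, ContinuousMap.coe_mk, mul_assoc] using hxy x x.2 y y.2
    exact hggm_right hy
  refine ⟨hsep, fun e heK he => ?_⟩
  by_contra! htriv
  have hcollapse : ∀ s, e * s * e = e := by
    intro s
    have hK : e * s * e ∈ K := hl _ _ heK
    have hes : e * (e * s * e) = e * s * e := by simp only [← mul_assoc, he]
    have hse : e * s * e * e = e * s * e := by rw [mul_assoc, he]
    obtain ⟨a, b, hab⟩ := hKmin _ (isIdeal_setOf_mul_mul (e * s * e)) heK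
    obtain ⟨z, hez, hxz, hzx⟩ := exists_local_inverse_of_eq_mul_mul he hes hse hab
    by_contra hne
    exact htriv _ hK hne hse hes z (hez ▸ hr z e heK) hxz hzx
  obtain ⟨s, t, hst⟩ := exists_pair_ne S
  obtain ⟨x, hx, y, hy, hxy⟩ := hsep s t hst
  obtain ⟨a, b, rfl⟩ := hKmin _ (isIdeal_setOf_mul_mul e) hx
  obtain ⟨c, d, rfl⟩ := hKmin _ (isIdeal_setOf_mul_mul e) hy
  have hconst : ∀ u, a * e * b * u * (c * e * d) = a * e * d := fun u => by
    calc a * e * b * u * (c * e * d) = a * (e * (b * u * c) * e) * d := by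
          simp only [mul_assoc]
      _ = a * e * d := by rw [hcollapse]
  exact hxy ((hconst s).trans (hconst t).symm)
end

section
/- Let p be an odd prime and let G = ℤ/pℤ, written additively (so G is a monoid and G¹ = G). Let f : G → G be the function with f(2) = 1 and f(x) = 0 for all x ≠ 2, and form the semigroup M(G,G,f). Then the subset consisting of the element 0 of the first (semigroup) component together with all triples (i, g, j) with i, j ∈ {0,1} ⊆ G and g ∈ G is a subsemigroup of M(G,G,f); it is a monoid whose identity is the element 0 of the first component, and it is isomorphic as a monoid to the monoid obtained by adjoining an identity element to the Rees matrix semigroup K_p = {0,1} × (ℤ/pℤ) × {0,1} with multiplication (i,g,j)·(k,h,l) = (i, g + P(j,k) + h, l), where P(1,1) = 1 and P(j,k) = 0 for (j,k) ≠ (1,1). -/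
/-- The carrier of the synthesis construction `M(G,G,f)` for `G = ℤ/pℤ` (written additively,
so `G¹ = G`): the disjoint union `G ⊎ (G × G × G)`. -/
def MType (p : ℕ) : Type :=
  ZMod p ⊕ (ZMod p × ZMod p × ZMod p)

/-- The multiplication of the semigroup `M(G,G,f)` for `G = ℤ/pℤ` written additively. -/
def mulM (p : ℕ) (f : ZMod p → ZMod p) : MType p → MType p → MType p
  | Sum.inl s, Sum.inl s' => Sum.inl (s + s')
  | Sum.inl s, Sum.inr x => Sum.inr (s + x.1, x.2.1, x.2.2)
  | Sum.inr x, Sum.inl s => Sum.inr (x.1, x.2.1, x.2.2 + s)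
  | Sum.inr x, Sum.inr y => Sum.inr (x.1, x.2.1 + f (x.2.2 + y.1) + y.2.1, y.2.2)

/-- The function `f : G → G` with `f 2 = 1` and `f x = 0` otherwise. -/
def fTwo (p : ℕ) : ZMod p → ZMod p := fun x => if x = 2 then 1 else 0

/-- The subset of `M(G,G,f)` consisting of the element `0` of the first (semigroup) component
together with all triples `(i,g,j)` with `i, j ∈ {0,1} ⊆ G`. -/
def mCarrier (p : ℕ) : Set (MType p) :=
  {x | x = Sum.inl 0 ∨
    ∃ i g j : ZMod p, (i = 0 ∨ i = 1) ∧ (j = 0 ∨ j = 1) ∧ x = Sum.inr (i, g, j)}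

/-- The sandwich function of the Rees matrix semigroup `K_p`: `P 1 1 = 1`, else `0`. -/
def sandwichP (p : ℕ) : Fin 2 → Fin 2 → ZMod p :=
  fun j k => if j = 1 ∧ k = 1 then 1 else 0

/-- The Rees matrix semigroup `K_p = {0,1} × ℤ/pℤ × {0,1}`. -/
def KpT (p : ℕ) : Type := Fin 2 × ZMod p × Fin 2

/-- Multiplication of `K_p`: `(i,g,j)·(k,h,l) = (i, g + P j k + h, l)`. -/
def mulKp (p : ℕ) (x y : KpT p) : KpT p :=
  (x.1, x.2.1 + sandwichP p x.2.2 y.1 + y.2.1, y.2.2)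

/-- `K_p` with an identity element (`none`) adjoined. -/
def Kp1T (p : ℕ) : Type := Option (KpT p)

/-- Multiplication of `K_p¹`, with `none` as adjoined identity. -/
def mulKp1 (p : ℕ) : Kp1T p → Kp1T p → Kp1T p
  | none, x => x
  | x, none => x
  | some a, some b => some (mulKp p a b)

/-- The operation of `M(G,G,f)` is associative. -/
theorem mulM_assoc (p : ℕ) (f : ZMod p → ZMod p) (x y z : MType p) :
    mulM p f (mulM p f x y) z = mulM p f x (mulM p f y z) := by
  rcases x with x | x <;> rcases y with y | y <;> rcases z with z | z <;>
    simp only [mulM, add_assoc] <;> rfl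

theorem inl_zero_mulM (p : ℕ) (f : ZMod p → ZMod p) (x : MType p) :
    mulM p f (Sum.inl 0) x = x := by
  rcases x with x | x <;> simp only [mulM, zero_add] <;> rfl

theorem mulM_inl_zero (p : ℕ) (f : ZMod p → ZMod p) (x : MType p) :
    mulM p f x (Sum.inl 0) = x := by
  rcases x with x | x <;> simp only [mulM, add_zero] <;> rfl

/-- The inclusion of the index set `{0,1}` in `ℤ/pℤ`. -/
def indexToZMod (p : ℕ) (i : Fin 2) : ZMod p := if i = 1 then 1 else 0

theorem indexToZMod_injective (p : ℕ) [Fact (1 < p)] :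
    Function.Injective (indexToZMod p) := by
  intro i j h
  fin_cases i <;> fin_cases j <;> simp_all [indexToZMod]

theorem exists_indexToZMod_eq_iff (p : ℕ) (a : ZMod p) :
    (∃ i, indexToZMod p i = a) ↔ a = 0 ∨ a = 1 := by
  simp [Fin.exists_fin_two, indexToZMod, eq_comm]

/-- On sums of indices, `fTwo` is the sandwich function of `K_p`. -/
theorem fTwo_indexToZMod_add (p : ℕ) [Fact (2 < p)] (j k : Fin 2) :
    fTwo p (indexToZMod p j + indexToZMod p k) = sandwichP p j k := by
  have : Fact (1 < p) := ⟨by have := Fact.out (p := 2 < p); omega⟩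
  have h2 : (0 : ZMod p) ≠ 2 := by
    intro h
    have h' : ((2 : ℕ) : ZMod p) = 0 := by exact_mod_cast h.symm
    exact absurd (Nat.le_of_dvd two_pos ((ZMod.natCast_eq_zero_iff _ _).1 h'))
      (not_le.2 Fact.out)
  have h1 : (1 : ZMod p) ≠ 2 := by
    intro h
    rw [← one_add_one_eq_two, left_eq_add] at h
    exact one_ne_zero h
  fin_cases j <;> fin_cases k <;>
    simp [fTwo, indexToZMod, sandwichP, h1, h2, one_add_one_eq_two]

/-- The embedding of `K_p¹` in `M(G,G,f)`. -/
def kp1ToM (p : ℕ) : Kp1T p → MType p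
  | none => Sum.inl 0
  | some x => Sum.inr (indexToZMod p x.1, x.2.1, indexToZMod p x.2.2)

theorem kp1ToM_injective (p : ℕ) [Fact (1 < p)] : Function.Injective (kp1ToM p) := by
  rintro (_ | ⟨i, g, j⟩) (_ | ⟨k, h, l⟩) hxy
  · rfl
  · exact absurd hxy Sum.inl_ne_inr
  · exact absurd hxy Sum.inr_ne_inl
  · have hxy' := Sum.inr_injective hxy
    simp only [Prod.mk.injEq] at hxy'
    obtain ⟨hi, rfl, hj⟩ := hxy'
    rw [indexToZMod_injective p hi, indexToZMod_injective p hj]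

theorem range_kp1ToM (p : ℕ) : Set.range (kp1ToM p) = mCarrier p := by
  ext x
  constructor
  · rintro ⟨_ | ⟨i, g, j⟩, rfl⟩
    · exact Or.inl rfl
    · exact Or.inr ⟨_, g, _, (exists_indexToZMod_eq_iff p _).1 ⟨i, rfl⟩,
        (exists_indexToZMod_eq_iff p _).1 ⟨j, rfl⟩, rfl⟩
  · rintro (rfl | ⟨a, g, b, ha, hb, rfl⟩)
    · exact ⟨none, rfl⟩
    · obtain ⟨i, rfl⟩ := (exists_indexToZMod_eq_iff p a).2 ha
      obtain ⟨j, rfl⟩ := (exists_indexToZMod_eq_iff p b).2 hb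
      exact ⟨some (i, g, j), rfl⟩

theorem kp1ToM_mulKp1 (p : ℕ) [Fact (2 < p)] (x y : Kp1T p) :
    kp1ToM p (mulKp1 p x y) = mulM p (fTwo p) (kp1ToM p x) (kp1ToM p y) := by
  rcases x with _ | x
  · exact (inl_zero_mulM p _ _).symm
  · rcases y with _ | y
    · exact (mulM_inl_zero p _ _).symm
    · exact congrArg (fun t : ZMod p => (Sum.inr (indexToZMod p x.1, x.2.1 + t + y.2.1,
        indexToZMod p y.2.2) : MType p)) (fTwo_indexToZMod_add p x.2.2 y.1).symm

/-- For an odd prime `p`, with `G = ℤ/pℤ` and `f` mapping `2 ↦ 1` and everything else to `0`,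
the subset of `M(G,G,f)` consisting of `0 ∈ G` together with all triples `(i,g,j)` with
`i,j ∈ {0,1}` is a subsemigroup; it is a monoid with identity the element `0` of the first
component, and it is isomorphic as a monoid to `K_p¹`. -/
theorem synthesis_gives_Kp1 (p : ℕ) (hp : p.Prime) (hodd : Odd p) :
    (∀ x ∈ mCarrier p, ∀ y ∈ mCarrier p, mulM p (fTwo p) x y ∈ mCarrier p) ∧
    (∀ x ∈ mCarrier p, ∀ y ∈ mCarrier p, ∀ z ∈ mCarrier p,
      mulM p (fTwo p) (mulM p (fTwo p) x y) z = mulM p (fTwo p) x (mulM p (fTwo p) y z)) ∧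
    Sum.inl 0 ∈ mCarrier p ∧
    (∀ x ∈ mCarrier p,
      mulM p (fTwo p) (Sum.inl 0) x = x ∧ mulM p (fTwo p) x (Sum.inl 0) = x) ∧
    ∃ e : {x : MType p // x ∈ mCarrier p} ≃ Kp1T p,
      (∀ h : (Sum.inl 0 : MType p) ∈ mCarrier p, e ⟨Sum.inl 0, h⟩ = none) ∧
      ∀ (x y : {x : MType p // x ∈ mCarrier p})
        (h : mulM p (fTwo p) x.1 y.1 ∈ mCarrier p),
        e ⟨mulM p (fTwo p) x.1 y.1, h⟩ = mulKp1 p (e x) (e y) := by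
  have hp2 : Fact (2 < p) := ⟨hp.two_le.lt_of_ne fun h => by
    subst h
    exact absurd hodd (by decide)⟩
  have : Fact (1 < p) := ⟨hp.one_lt⟩
  refine ⟨?_, fun x _ y _ z _ => mulM_assoc p _ x y z, Or.inl rfl,
    fun x _ => ⟨inl_zero_mulM p _ x, mulM_inl_zero p _ x⟩, ?_⟩
  · rw [← range_kp1ToM]
    rintro _ ⟨x, rfl⟩ _ ⟨y, rfl⟩
    exact ⟨mulKp1 p x y, kp1ToM_mulKp1 p x y⟩
  · let e : Kp1T p ≃ {x : MType p // x ∈ mCarrier p} :=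
      (Equiv.ofInjective _ (kp1ToM_injective p)).trans (Equiv.setCongr (range_kp1ToM p))
    have he (x : Kp1T p) : (e x).1 = kp1ToM p x := rfl
    refine ⟨e.symm, fun h => ?_, fun x y h => ?_⟩
    · exact e.symm_apply_eq.2 rfl
    · rw [Equiv.symm_apply_eq, Subtype.ext_iff, he, kp1ToM_mulKp1, ← he, ← he,
        Equiv.apply_symm_apply, Equiv.apply_symm_apply]
end
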